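/- arXiv:math/0510251 — 3 statements merged into one kernel-verified Lean document; each statement's English description precedes it below -/
import Mathlib

section
/- Let k be a field, A a k-algebra, and let P, M, I be A-modules. Assume: P is a projective A-module; S is a simple A-submodule of I such that every nonzero A-submodule of I contains S; there exists a nonzero A-linear map from P to I whose image is contained in S; and ζ : M → I is an A-linear map. Then for every A-submodule M′ of M that is NOT contained in ker ζ, there exists a nonzero A-linear map φ : P → M whose image is contained in M′. -/
/-- Claim 1 in the proof of the submodule-dichotomy lemma: if `P` is projective,
`S` is a simple submodule of `I` contained in every nonzero submodule of `I`,
there is a nonzero map `P → I` with image in `S`, and `ζ : M → I` is any map,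
then every submodule `M′` of `M` not contained in `ker ζ` admits a nonzero map
`φ : P → M` with image contained in `M′`. -/
theorem exists_nonzero_map_into_submodule
    (k A : Type*) [Field k] [Ring A] [Algebra k A]
    (P M I : Type*)
    [AddCommGroup P] [Module A P]
    [AddCommGroup M] [Module A M]
    [AddCommGroup I] [Module A I]
    (hproj : Module.Projective A P)
    (S : Submodule A I) (hS : IsSimpleModule A S)
    (hess : ∀ N : Submodule A I, N ≠ ⊥ → S ≤ N)
    (hPI : ∃ f : P →ₗ[A] I, f ≠ 0 ∧ LinearMap.range f ≤ S)
    (ζ : M →ₗ[A] I) :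
    ∀ M' : Submodule A M, ¬ (M' ≤ LinearMap.ker ζ) →
      ∃ φ : P →ₗ[A] M, φ ≠ 0 ∧ LinearMap.range φ ≤ M' := by
  intro M' hM'
  obtain ⟨f, hf, hfS⟩ := hPI
  have hS_le : S ≤ M'.map ζ :=
    hess _ fun h => hM' (LinearMap.le_ker_iff_map.mpr h)
  obtain ⟨g, hg⟩ := Module.projective_lifting_property (ζ.submoduleMap M')
    (f.codRestrict (M'.map ζ) fun p => hS_le (hfS ⟨p, rfl⟩)) (ζ.submoduleMap_surjective M')
  have hlift : ζ ∘ₗ M'.subtype ∘ₗ g = f := by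
    ext p
    exact congrArg Subtype.val (LinearMap.congr_fun hg p)
  refine ⟨M'.subtype ∘ₗ g, fun h => hf ?_, ?_⟩
  · rw [← hlift, h, LinearMap.comp_zero]
  · rintro _ ⟨p, rfl⟩
    exact (g p).2
end

section
/- Let K be the fraction field of ℤ[x₁,x₂] and let y : ℕ → K satisfy y₀ = x₂, y₁ = x₁, yₙ ≠ 0 for all n, and yₙ·yₙ₊₂ = yₙ₊₁² + 1 for all n ≥ 0. Then the sequence satisfies the three-term linear recurrence x₁·x₂·(yₙ₊₂ + yₙ) = (1 + x₁² + x₂²)·yₙ₊₁ for all n ≥ 0; equivalently, w₁·yₙ₊₁ = yₙ₊₂ + yₙ where w₁ = (1 + x₁² + x₂²)/(x₁x₂). -/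
open MvPolynomial

/-- A nowhere vanishing sequence in an integral domain with `yₙ · yₙ₊₂ = yₙ₊₁² + c` satisfies a
linear three-term recurrence whose coefficients depend only on `y₀`, `y₁` and `c`. -/
theorem linear_recurrence_of_mul_eq_sq_add {R : Type*} [CommRing R] [IsDomain R] {y : ℕ → R} {c : R}
    (hyne : ∀ n, y n ≠ 0) (hrec : ∀ n, y n * y (n + 2) = y (n + 1) ^ 2 + c) (n : ℕ) :
    y 1 * y 0 * (y (n + 2) + y n) = (c + y 1 ^ 2 + y 0 ^ 2) * y (n + 1) := by
  induction n with
  | zero => linear_combination y 1 * hrec 0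
  | succ n ih =>
    apply mul_right_cancel₀ (hyne (n + 1))
    linear_combination
      y (n + 2) * ih + y 1 * y 0 * hrec (n + 1) - y 1 * y 0 * hrec n

/-- The cluster variables of the Kronecker quiver satisfy the linear three-term
recurrence `w₁ · yₙ₊₁ = yₙ₊₂ + yₙ` with `w₁ = (1 + x₁² + x₂²)/(x₁x₂)`, in the
cleared-denominator form `x₁·x₂·(yₙ₊₂ + yₙ) = (1 + x₁² + x₂²)·yₙ₊₁`. -/
theorem kronecker_linear_recurrence
    (y : ℕ → FractionRing (MvPolynomial (Fin 2) ℤ))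
    (x₁ x₂ : FractionRing (MvPolynomial (Fin 2) ℤ))
    (hx₁ : x₁ = algebraMap (MvPolynomial (Fin 2) ℤ) _ (X 0))
    (hx₂ : x₂ = algebraMap (MvPolynomial (Fin 2) ℤ) _ (X 1))
    (hy0 : y 0 = x₂) (hy1 : y 1 = x₁)
    (hyne : ∀ n, y n ≠ 0)
    (hrec : ∀ n, y n * y (n + 2) = (y (n + 1)) ^ 2 + 1) :
    ∀ n, x₁ * x₂ * (y (n + 2) + y n) = (1 + x₁ ^ 2 + x₂ ^ 2) * y (n + 1) := by
  subst hy0 hy1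
  exact linear_recurrence_of_mul_eq_sq_add hyne hrec
end

section
/- Let K be the fraction field of ℤ[x₁,x₂] and let y : ℕ → K satisfy y₀ = x₂, y₁ = x₁, yₙ ≠ 0 for all n, and yₙ·yₙ₊₂ = yₙ₊₁² + 1 for all n ≥ 0. Then for every n ≥ 0 there exists a weakly positive polynomial P ∈ ℤ[x₁,x₂], divisible neither by x₁ nor by x₂, such that yₙ₊₂ · x₁ⁿ x₂^{n+1} = P in K. In other words, yₙ₊₂ is a weakly positive Laurent polynomial in x₁, x₂ whose denominator is exactly x₁ⁿ x₂^{n+1}. -/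
open MvPolynomial

/-- `P` is weakly positive if `P(z) > 0` for each `z ∈ ℕⁿ` with at most one
vanishing component. -/
def WeaklyPositive {n : ℕ} (P : MvPolynomial (Fin n) ℤ) : Prop :=
  ∀ z : Fin n → ℕ,
    (Finset.univ.filter (fun i => z i = 0)).card ≤ 1 →
      0 < eval (fun i => (z i : ℤ)) P

/-- The numerator of `yₙ₊₂` over the denominator `x₁ⁿ x₂^{n+1}`. -/
noncomputable def kroneckerNumerator : ℕ → MvPolynomial (Fin 2) ℤ
  | 0 => X 0 ^ 2 + 1
  | 1 => (X 0 ^ 2 + 1) ^ 2 + X 1 ^ 2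
  | n + 2 => (X 0 ^ 2 + X 1 ^ 2 + 1) * kroneckerNumerator (n + 1)
      - X 0 ^ 2 * X 1 ^ 2 * kroneckerNumerator n

theorem eval_kroneckerNumerator_pos (z : Fin 2 → ℤ) (n : ℕ) :
    0 < eval z (kroneckerNumerator n) := by
  suffices h : 0 < eval z (kroneckerNumerator n) ∧
      z 0 ^ 2 * eval z (kroneckerNumerator n) < eval z (kroneckerNumerator (n + 1)) from h.1
  induction n with
  | zero =>
    simp only [kroneckerNumerator, map_add, map_pow, map_one, eval_X]
    constructor
    · positivity
    · nlinarith [sq_nonneg (z 0), sq_nonneg (z 1)]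
  | succ n ih =>
    obtain ⟨hpos, hlt⟩ := ih
    have hpos' : 0 < eval z (kroneckerNumerator (n + 1)) :=
      lt_of_le_of_lt (by positivity) hlt
    refine ⟨hpos', ?_⟩
    simp only [kroneckerNumerator, map_add, map_sub, map_mul, map_pow, map_one, eval_X]
    nlinarith [mul_nonneg (sq_nonneg (z 1)) (sub_nonneg.2 hlt.le)]

theorem not_X_dvd_kroneckerNumerator (i : Fin 2) (n : ℕ) : ¬ X i ∣ kroneckerNumerator n := by
  rintro ⟨Q, hQ⟩
  have h := eval_kroneckerNumerator_pos 0 n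
  simp [hQ] at h

/-- The conserved quantity `(x₁² + x₂² + 1) / (x₁ x₂)` linearizes the exchange relations. -/
theorem exchange_linear_recurrence {K : Type*} [Field K] {y : ℕ → K} (hyne : ∀ n, y n ≠ 0)
    (hrec : ∀ n, y n * y (n + 2) = y (n + 1) ^ 2 + 1) (n : ℕ) :
    y 1 * y 0 * (y n + y (n + 2)) = (y 1 ^ 2 + y 0 ^ 2 + 1) * y (n + 1) := by
  induction n with
  | zero => linear_combination y 1 * hrec 0
  | succ n ih =>
    apply mul_left_cancel₀ (hyne (n + 1))
    linear_combination y 1 * y 0 * hrec (n + 1) - y 1 * y 0 * hrec n + y (n + 2) * ih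

/-- Denominator theorem for the Kronecker quiver: the cluster variable `yₙ₊₂`
is a weakly positive Laurent polynomial whose denominator is exactly
`x₁ⁿ x₂^{n+1}`. -/
theorem kronecker_denominator
    (y : ℕ → FractionRing (MvPolynomial (Fin 2) ℤ))
    (x₁ x₂ : FractionRing (MvPolynomial (Fin 2) ℤ))
    (hx₁ : x₁ = algebraMap (MvPolynomial (Fin 2) ℤ) _ (X 0))
    (hx₂ : x₂ = algebraMap (MvPolynomial (Fin 2) ℤ) _ (X 1))
    (hy0 : y 0 = x₂) (hy1 : y 1 = x₁)
    (hyne : ∀ n, y n ≠ 0)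
    (hrec : ∀ n, y n * y (n + 2) = (y (n + 1)) ^ 2 + 1) :
    ∀ n : ℕ, ∃ P : MvPolynomial (Fin 2) ℤ,
      WeaklyPositive P ∧ ¬ (X 0 ∣ P) ∧ ¬ (X 1 ∣ P) ∧
      y (n + 2) * x₁ ^ n * x₂ ^ (n + 1)
        = algebraMap (MvPolynomial (Fin 2) ℤ) (FractionRing (MvPolynomial (Fin 2) ℤ)) P := by
  have hnum : ∀ n, y (n + 2) * x₁ ^ n * x₂ ^ (n + 1)
      = algebraMap (MvPolynomial (Fin 2) ℤ) (FractionRing (MvPolynomial (Fin 2) ℤ))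
          (kroneckerNumerator n) := by
    have hlin := exchange_linear_recurrence hyne hrec
    have h0 := hrec 0
    have h1 := hrec 1
    simp only [zero_add, Nat.reduceAdd, hy0, hy1] at hlin h0 h1
    intro n
    induction n using Nat.twoStepInduction with
    | zero =>
      simp only [kroneckerNumerator, map_add, map_pow, map_one, ← hx₁]
      linear_combination h0
    | one =>
      simp only [kroneckerNumerator, map_add, map_pow, map_one, ← hx₁, ← hx₂]
      linear_combination x₂ ^ 2 * h1 + (x₂ * y 2 + x₁ ^ 2 + 1) * h0
    | more n ih ih' =>
      simp only [kroneckerNumerator, map_add, map_sub, map_mul, map_pow, map_one, ← hx₁, ← hx₂,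
        ← ih, ← ih']
      linear_combination x₁ ^ (n + 1) * x₂ ^ (n + 2) * hlin (n + 2)
  exact fun n => ⟨kroneckerNumerator n, fun z _ => eval_kroneckerNumerator_pos _ n,
    not_X_dvd_kroneckerNumerator 0 n, not_X_dvd_kroneckerNumerator 1 n, hnum n⟩
end
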